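/- In the setting of the previous statement, viewing $S_{a:b}$ as a function $S_{a:b}(E)$ of the perturbation, for any two perturbations $E, E'$ with $\max\{\|E\|_{op}, \|E'\|_{op}\} \leq g_{a:b}/4$ one has the Lipschitz bound $\|S_{a:b}(E) - S_{a:b}(E')\|_{op} \leq 1024\left(1 + \frac{\sigma_a - \sigma_b}{g_{a:b}}\right) \frac{\max\{\|E\|_{op}, \|E'\|_{op}\}}{g_{a:b}^2} \, \|E - E'\|_{op}$. -/

import Mathlib

open Matrix Finset

noncomputable def vnorm {ι : Type*} [Fintype ι] (v : ι → ℝ) : ℝ :=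
  Real.sqrt (∑ i, v i ^ 2)

noncomputable def opNorm {m n : Type*} [Fintype m] [Fintype n]
    (A : Matrix m n ℝ) : ℝ :=
  ⨆ v : {v : n → ℝ // vnorm v ≤ 1}, vnorm (A.mulVec v)

variable (p n k a b : ℕ)
variable (V : Matrix (Fin n) {i // i ∈ Finset.Icc 1 k} ℝ)
variable (Vab Vhatab Vhatab' : Matrix (Fin n) {i // i ∈ Finset.Icc a b} ℝ)
variable (S S' : Matrix (Fin n) {i // i ∈ Finset.Icc a b} ℝ)
variable (M E E' : Matrix (Fin p) (Fin n) ℝ)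
variable (σ : ℕ → ℝ) (u : ℕ → Fin p → ℝ) (v : ℕ → Fin n → ℝ)

section SingularValuePerturbation

open scoped Matrix.Norms.L2Operator

section EuclideanNorm

variable {l m n : Type*} [Fintype l] [Fintype m] [Fintype n]

theorem vnorm_eq_norm_toLp (x : n → ℝ) : vnorm x = ‖WithLp.toLp 2 x‖ := by
  simp [vnorm, EuclideanSpace.norm_eq]

theorem vnorm_nonneg (x : n → ℝ) : 0 ≤ vnorm x := Real.sqrt_nonneg _

theorem vnorm_sq (x : n → ℝ) : vnorm x ^ 2 = x ⬝ᵥ x := by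
  rw [vnorm, Real.sq_sqrt (Finset.sum_nonneg fun i _ => sq_nonneg _)]
  simp [dotProduct, sq]

theorem vnorm_pos {x : n → ℝ} (hx : x ≠ 0) : 0 < vnorm x := by
  rw [vnorm_eq_norm_toLp, norm_pos_iff]
  simpa using hx

theorem vnorm_mulVec_le [DecidableEq n] (A : Matrix m n ℝ) (x : n → ℝ) :
    vnorm (A *ᵥ x) ≤ ‖A‖ * vnorm x := by
  simpa [vnorm_eq_norm_toLp] using Matrix.l2_opNorm_mulVec A (WithLp.toLp 2 x)

theorem l2_norm_le_of_vnorm_mulVec_le [DecidableEq n] {A : Matrix m n ℝ} {C : ℝ} (hC : 0 ≤ C)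
    (h : ∀ x, vnorm (A *ᵥ x) ≤ C * vnorm x) : ‖A‖ ≤ C := by
  rw [Matrix.l2_opNorm_def]
  refine ContinuousLinearMap.opNorm_le_bound _ hC fun x => ?_
  have := h x.ofLp
  rw [vnorm_eq_norm_toLp, vnorm_eq_norm_toLp] at this
  exact this

theorem opNorm_eq_l2_norm [DecidableEq n] (A : Matrix m n ℝ) : opNorm A = ‖A‖ := by
  have hle : ∀ x : {x : n → ℝ // vnorm x ≤ 1}, vnorm (A *ᵥ x.1) ≤ ‖A‖ := fun x =>
    (vnorm_mulVec_le A x.1).trans (mul_le_of_le_one_right (norm_nonneg _) x.2)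
  have hzero : vnorm (0 : n → ℝ) ≤ 1 := by simp [vnorm]
  have : Nonempty {x : n → ℝ // vnorm x ≤ 1} := ⟨⟨0, hzero⟩⟩
  have hbdd : BddAbove (Set.range fun x : {x : n → ℝ // vnorm x ≤ 1} => vnorm (A *ᵥ x.1)) :=
    ⟨‖A‖, by rintro _ ⟨x, rfl⟩; exact hle x⟩
  refine le_antisymm (ciSup_le hle) (l2_norm_le_of_vnorm_mulVec_le
    ((vnorm_nonneg _).trans (le_ciSup hbdd ⟨0, hzero⟩)) fun x => ?_)
  rcases eq_or_ne x 0 with rfl | hx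
  · simp [vnorm]
  have hpos := vnorm_pos hx
  have hsmul : ∀ {ι : Type _} [Fintype ι] (c : ℝ) (y : ι → ℝ), vnorm (c • y) = |c| * vnorm y := by
    intro ι _ c y
    simp [vnorm_eq_norm_toLp, norm_smul]
  have hunit : vnorm ((vnorm x)⁻¹ • x) ≤ 1 := by
    simp only [vnorm_eq_norm_toLp, WithLp.toLp_smul, norm_smul, norm_inv, norm_norm] at hpos ⊢
    exact (inv_mul_cancel₀ hpos.ne').le
  have hsup := le_ciSup hbdd ⟨_, hunit⟩
  simp only [Matrix.mulVec_smul] at hsup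
  rw [hsmul, abs_inv, abs_of_pos hpos, inv_mul_le_iff₀ hpos, mul_comm] at hsup
  exact hsup

theorem l2_norm_transpose [DecidableEq m] [DecidableEq n] (A : Matrix m n ℝ) : ‖Aᵀ‖ = ‖A‖ := by
  rw [← Matrix.conjTranspose_eq_transpose_of_trivial, Matrix.l2_opNorm_conjTranspose]

theorem l2_norm_le_one_of_transpose_mul_self [DecidableEq n] {P : Matrix n n ℝ}
    (h : Pᵀ * P = P) : ‖P‖ ≤ 1 := by
  have h2 := Matrix.l2_opNorm_conjTranspose_mul_self P
  rw [Matrix.conjTranspose_eq_transpose_of_trivial, h] at h2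
  nlinarith [norm_nonneg P]

theorem l2_norm_le_one_of_mul_transpose_self [DecidableEq m] [DecidableEq n] {W : Matrix m n ℝ}
    (h : ‖W * Wᵀ‖ ≤ 1) : ‖W‖ ≤ 1 := by
  have h2 := Matrix.l2_opNorm_conjTranspose_mul_self Wᵀ
  rw [Matrix.conjTranspose_eq_transpose_of_trivial, Matrix.transpose_transpose,
    l2_norm_transpose] at h2
  nlinarith [norm_nonneg W]

theorem l2_norm_mul_le_of_le [DecidableEq m] [DecidableEq n] {A : Matrix l m ℝ}
    {B : Matrix m n ℝ} {s t : ℝ} (hA : ‖A‖ ≤ s) (hB : ‖B‖ ≤ t) : ‖A * B‖ ≤ s * t :=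
  (Matrix.l2_opNorm_mul A B).trans
    (mul_le_mul hA hB (norm_nonneg _) ((norm_nonneg _).trans hA))

end EuclideanNorm

section RankSum

variable {l m n : Type*}

/-- Orthonormality of the vectors `x i` for `i ∈ S`. -/
def OrthonormalFamilyOn [Fintype n] (S : Finset ℕ) (x : ℕ → n → ℝ) : Prop :=
  ∀ i ∈ S, ∀ j ∈ S, x i ⬝ᵥ x j = if i = j then (1 : ℝ) else 0

/-- The weighted sum of the rank-one matrices `x i (y i)ᵀ` over `i ∈ S`. -/
def rankSum (S : Finset ℕ) (c : ℕ → ℝ) (x : ℕ → m → ℝ) (y : ℕ → n → ℝ) : Matrix m n ℝ :=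
  ∑ i ∈ S, c i • Matrix.vecMulVec (x i) (y i)

theorem rankSum_congr {S : Finset ℕ} {c d : ℕ → ℝ} (h : ∀ i ∈ S, c i = d i)
    (x : ℕ → m → ℝ) (y : ℕ → n → ℝ) : rankSum S c x y = rankSum S d x y :=
  Finset.sum_congr rfl fun i hi => by rw [h i hi]

theorem rankSum_transpose (S : Finset ℕ) (c : ℕ → ℝ) (x : ℕ → m → ℝ) (y : ℕ → n → ℝ) :
    (rankSum S c x y)ᵀ = rankSum S c y x := by
  simp [rankSum, Matrix.transpose_sum, Matrix.transpose_vecMulVec]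

theorem rankSum_sub (S : Finset ℕ) (c d : ℕ → ℝ) (x : ℕ → m → ℝ) (y : ℕ → n → ℝ) :
    rankSum S c x y - rankSum S d x y = rankSum S (fun i => c i - d i) x y := by
  simp [rankSum, sub_smul]

theorem rankSum_indicator {S T : Finset ℕ} (hTS : T ⊆ S) (c : ℕ → ℝ) (x : ℕ → m → ℝ)
    (y : ℕ → n → ℝ) :
    rankSum S (fun i => if i ∈ T then c i else 0) x y
      = ∑ i ∈ T, c i • Matrix.vecMulVec (x i) (y i) := by
  simp only [rankSum, ite_smul, zero_smul]
  rw [← Finset.sum_filter, Finset.filter_mem_eq_inter, Finset.inter_eq_right.mpr hTS]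

theorem rankSum_mulVec [Fintype n] (S : Finset ℕ) (c : ℕ → ℝ) (x : ℕ → m → ℝ) (y : ℕ → n → ℝ)
    (z : n → ℝ) : rankSum S c x y *ᵥ z = ∑ i ∈ S, (c i * (y i ⬝ᵥ z)) • x i := by
  simp only [rankSum, Matrix.sum_mulVec, Matrix.smul_mulVec, Matrix.vecMulVec_mulVec,
    op_smul_eq_smul, smul_smul]

theorem rankSum_mul [Fintype m] {S : Finset ℕ} {y : ℕ → m → ℝ} (hy : OrthonormalFamilyOn S y)
    (c d : ℕ → ℝ) (x : ℕ → l → ℝ) (z : ℕ → n → ℝ) :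
    rankSum S c x y * rankSum S d y z = rankSum S (fun i => c i * d i) x z := by
  simp only [rankSum, Matrix.sum_mul, Matrix.mul_sum]
  refine Finset.sum_congr rfl fun i hi => ?_
  rw [Finset.sum_eq_single_of_mem i hi]
  · simp [Matrix.vecMulVec_mul_vecMulVec, hy i hi i hi, smul_smul, mul_comm]
  · intro j hj hij
    have h0 : Matrix.vecMulVec (x j) (0 : n → ℝ) = 0 := by
      ext
      simp [Matrix.vecMulVec_apply]
    simp [Matrix.vecMulVec_mul_vecMulVec, hy j hj i hi, hij, h0]

theorem OrthonormalFamilyOn.dotProduct_sum [Fintype n] {S : Finset ℕ} {x : ℕ → n → ℝ}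
    (hx : OrthonormalFamilyOn S x) (t : ℕ → ℝ) {i : ℕ} (hi : i ∈ S) :
    x i ⬝ᵥ ∑ j ∈ S, t j • x j = t i := by
  rw [_root_.dotProduct_sum, Finset.sum_eq_single_of_mem i hi]
  · simp [hx i hi i hi]
  · intro j hj hij
    simp [hx i hi j hj, hij.symm]

theorem OrthonormalFamilyOn.sum_dotProduct_sum [Fintype n] {S : Finset ℕ} {x : ℕ → n → ℝ}
    (hx : OrthonormalFamilyOn S x) (t : ℕ → ℝ) :
    (∑ j ∈ S, t j • x j) ⬝ᵥ (∑ j ∈ S, t j • x j) = ∑ i ∈ S, t i ^ 2 := by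
  rw [sum_dotProduct]
  refine Finset.sum_congr rfl fun i hi => ?_
  rw [smul_dotProduct, hx.dotProduct_sum t hi, smul_eq_mul, sq]

theorem OrthonormalFamilyOn.bessel [Fintype n] {S : Finset ℕ} {x : ℕ → n → ℝ}
    (hx : OrthonormalFamilyOn S x) (z : n → ℝ) : ∑ i ∈ S, (x i ⬝ᵥ z) ^ 2 ≤ z ⬝ᵥ z := by
  set w := ∑ i ∈ S, (x i ⬝ᵥ z) • x i with hw
  have hww : w ⬝ᵥ w = ∑ i ∈ S, (x i ⬝ᵥ z) ^ 2 := hx.sum_dotProduct_sum _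
  have hwz : w ⬝ᵥ z = ∑ i ∈ S, (x i ⬝ᵥ z) ^ 2 := by
    simp [hw, sum_dotProduct, smul_dotProduct, sq]
  have hpos : 0 ≤ (z - w) ⬝ᵥ (z - w) := by
    rw [← vnorm_sq]
    positivity
  rw [sub_dotProduct, dotProduct_sub, dotProduct_sub, dotProduct_comm z w, hww, hwz] at hpos
  linarith

theorem l2_norm_rankSum_le [Fintype m] [Fintype n] [DecidableEq n] {S : Finset ℕ}
    {x : ℕ → m → ℝ} {y : ℕ → n → ℝ} (hx : OrthonormalFamilyOn S x)
    (hy : OrthonormalFamilyOn S y) {c : ℕ → ℝ} {C : ℝ} (hC : 0 ≤ C) (hc : ∀ i ∈ S, |c i| ≤ C) :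
    ‖rankSum S c x y‖ ≤ C := by
  refine l2_norm_le_of_vnorm_mulVec_le hC fun z => ?_
  refine le_of_sq_le_sq ?_ (mul_nonneg hC (vnorm_nonneg _))
  rw [mul_pow, vnorm_sq, vnorm_sq, rankSum_mulVec, hx.sum_dotProduct_sum]
  refine le_trans ?_ (mul_le_mul_of_nonneg_left (hy.bessel z) (sq_nonneg C))
  rw [Finset.mul_sum]
  refine Finset.sum_le_sum fun i hi => ?_
  rw [mul_pow]
  exact mul_le_mul_of_nonneg_right (sq_le_sq' (abs_le.mp (hc i hi)).1 (abs_le.mp (hc i hi)).2)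
    (sq_nonneg _)

theorem OrthonormalFamilyOn.l2_norm_one_sub_le [Fintype n] [DecidableEq n] {S : Finset ℕ}
    {x : ℕ → n → ℝ} (hx : OrthonormalFamilyOn S x) {c : ℕ → ℝ}
    (hc : ∀ i ∈ S, c i * c i = c i) : ‖1 - rankSum S c x x‖ ≤ 1 := by
  refine l2_norm_le_one_of_transpose_mul_self ?_
  rw [Matrix.transpose_sub, Matrix.transpose_one, rankSum_transpose, mul_sub, sub_mul, sub_mul,
    rankSum_mul hx, rankSum_congr hc]
  simp

/-- The orthogonal projection onto the vectors `x i` with `i ∈ T`, `1 ≤ i ≤ K`. -/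
noncomputable def bandProj (K : ℕ) (T : Finset ℕ) (x : ℕ → n → ℝ) : Matrix n n ℝ :=
  rankSum (Finset.Icc 1 K) (fun i => if i ∈ T then 1 else 0) x x

/-- The transposed pseudoinverse of the part of an SVD indexed by `T`. -/
noncomputable def bandInv (K : ℕ) (T : Finset ℕ) (σ : ℕ → ℝ) (u : ℕ → m → ℝ) (v : ℕ → n → ℝ) :
    Matrix m n ℝ :=
  rankSum (Finset.Icc 1 K) (fun i => if i ∈ T then (σ i)⁻¹ else 0) u v

theorem bandProj_transpose (K : ℕ) (T : Finset ℕ) (x : ℕ → n → ℝ) :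
    (bandProj K T x)ᵀ = bandProj K T x :=
  rankSum_transpose _ _ _ _

theorem bandInv_transpose (K : ℕ) (T : Finset ℕ) (σ : ℕ → ℝ) (u : ℕ → m → ℝ) (v : ℕ → n → ℝ) :
    (bandInv K T σ u v)ᵀ = bandInv K T σ v u :=
  rankSum_transpose _ _ _ _

theorem mul_transpose_eq_bandProj {K : ℕ} {T : Finset ℕ} (hT : T ⊆ Finset.Icc 1 K)
    {v : ℕ → n → ℝ} {W : Matrix n {i // i ∈ T} ℝ} (hW : ∀ x i, W x i = v i.1 x) :
    W * Wᵀ = bandProj K T v := by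
  rw [bandProj, rankSum_indicator hT]
  ext x y
  simp only [Matrix.mul_apply, Matrix.transpose_apply, hW, Matrix.sum_apply, one_smul,
    Matrix.vecMulVec_apply]
  exact Finset.sum_coe_sort T fun i => v i x * v i y

end RankSum

section IsSVD

variable {m n : Type*} [Fintype m] [Fintype n]

/-- `A = ∑ σ i • u i (v i)ᵀ` over `1 ≤ i ≤ K` is a singular value decomposition, where the singular
values are nonincreasing and extended by zero beyond `K`. -/
structure IsSVD (K : ℕ) (A : Matrix m n ℝ) (σ : ℕ → ℝ) (u : ℕ → m → ℝ) (v : ℕ → n → ℝ) :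
    Prop where
  nonneg : ∀ i, 0 ≤ σ i
  anti : ∀ i j, 1 ≤ i → i ≤ j → σ j ≤ σ i
  eq_zero : ∀ i, K < i → σ i = 0
  left : OrthonormalFamilyOn (Finset.Icc 1 K) u
  right : OrthonormalFamilyOn (Finset.Icc 1 K) v
  eq_rankSum : A = rankSum (Finset.Icc 1 K) σ u v

theorem IsSVD.of_le {K : ℕ} {A : Matrix m n ℝ} {σ : ℕ → ℝ} {u : ℕ → m → ℝ} {v : ℕ → n → ℝ}
    (hnonneg : ∀ i ∈ Finset.Icc 1 K, 0 ≤ σ i)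
    (hanti : ∀ i ∈ Finset.Icc 1 K, ∀ j ∈ Finset.Icc 1 K, i ≤ j → σ j ≤ σ i)
    (hu : OrthonormalFamilyOn (Finset.Icc 1 K) u) (hv : OrthonormalFamilyOn (Finset.Icc 1 K) v)
    (hA : A = ∑ i ∈ Finset.Icc 1 K, σ i • Matrix.vecMulVec (u i) (v i)) :
    IsSVD K A (fun i => if i ∈ Finset.Icc 1 K then σ i else 0) u v where
  nonneg i := by
    split_ifs with hi
    exacts [hnonneg i hi, le_rfl]
  anti i j hi hij := by
    by_cases hj : j ∈ Finset.Icc 1 K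
    · have hi' : i ∈ Finset.Icc 1 K := by
        rw [Finset.mem_Icc] at hj ⊢
        omega
      simpa only [if_pos hj, if_pos hi'] using hanti i hi' j hj hij
    · simp only [if_neg hj]
      split_ifs with hi'
      exacts [hnonneg i hi', le_rfl]
  eq_zero i hi := if_neg fun h => by
    rw [Finset.mem_Icc] at h
    omega
  left := hu
  right := hv
  eq_rankSum := by rw [hA, rankSum_indicator subset_rfl]

theorem OrthonormalFamilyOn.bandProj_mul_self {K : ℕ} {x : ℕ → n → ℝ}
    (hx : OrthonormalFamilyOn (Finset.Icc 1 K) x) (T : Finset ℕ) :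
    bandProj K T x * bandProj K T x = bandProj K T x := by
  rw [bandProj, rankSum_mul hx]
  exact rankSum_congr (fun i _ => by split_ifs <;> simp) _ _

theorem OrthonormalFamilyOn.l2_norm_bandProj_le [DecidableEq n] {K : ℕ} {x : ℕ → n → ℝ}
    (hx : OrthonormalFamilyOn (Finset.Icc 1 K) x) (T : Finset ℕ) : ‖bandProj K T x‖ ≤ 1 :=
  l2_norm_le_one_of_transpose_mul_self (by rw [bandProj_transpose, hx.bandProj_mul_self])

theorem OrthonormalFamilyOn.l2_norm_one_sub_bandProj_le [DecidableEq n] {K : ℕ} {x : ℕ → n → ℝ}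
    (hx : OrthonormalFamilyOn (Finset.Icc 1 K) x) (T : Finset ℕ) : ‖1 - bandProj K T x‖ ≤ 1 :=
  hx.l2_norm_one_sub_le fun i _ => by split_ifs <;> simp

namespace IsSVD

variable {K : ℕ} {A : Matrix m n ℝ} {σ : ℕ → ℝ} {u : ℕ → m → ℝ} {v : ℕ → n → ℝ}

theorem transpose (hA : IsSVD K A σ u v) : IsSVD K Aᵀ σ v u where
  nonneg := hA.nonneg
  anti := hA.anti
  eq_zero := hA.eq_zero
  left := hA.right
  right := hA.left
  eq_rankSum := by rw [hA.eq_rankSum, rankSum_transpose]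

theorem mul_bandProj (hA : IsSVD K A σ u v) (T : Finset ℕ) :
    A * bandProj K T v = rankSum (Finset.Icc 1 K) (fun i => if i ∈ T then σ i else 0) u v := by
  rw [hA.eq_rankSum, bandProj, rankSum_mul hA.right]
  exact rankSum_congr (fun i _ => by split_ifs <;> simp) _ _

theorem bandProj_mul (hA : IsSVD K A σ u v) (T : Finset ℕ) :
    bandProj K T u * A = A * bandProj K T v := by
  rw [hA.mul_bandProj, hA.eq_rankSum, bandProj, rankSum_mul hA.left]
  exact rankSum_congr (fun i _ => by split_ifs <;> simp) _ _

theorem bandInv_mul_bandProj (hA : IsSVD K A σ u v) (T : Finset ℕ) :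
    bandInv K T σ u v * bandProj K T v = bandInv K T σ u v := by
  rw [bandInv, bandProj, rankSum_mul hA.right]
  exact rankSum_congr (fun i _ => by split_ifs <;> simp) _ _

theorem transpose_mul_bandInv (hA : IsSVD K A σ u v) {T : Finset ℕ} (hT : ∀ i ∈ T, σ i ≠ 0) :
    Aᵀ * bandInv K T σ u v = bandProj K T v := by
  rw [hA.transpose.eq_rankSum, bandInv, bandProj, rankSum_mul hA.left]
  refine rankSum_congr (fun i _ => ?_) _ _
  split_ifs with hi
  · exact mul_inv_cancel₀ (hT i hi)
  · simp

theorem transpose_bandInv_mul (hA : IsSVD K A σ u v) {T : Finset ℕ} (hT : ∀ i ∈ T, σ i ≠ 0) :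
    (bandInv K T σ u v)ᵀ * A = bandProj K T v := by
  have h := congrArg Matrix.transpose (hA.transpose_mul_bandInv hT)
  rwa [Matrix.transpose_mul, Matrix.transpose_transpose, bandProj_transpose] at h

theorem l2_norm_bandInv_le [DecidableEq n] (hA : IsSVD K A σ u v) {T : Finset ℕ} {s : ℝ}
    (hs : 0 < s) (hT : ∀ i ∈ T, s ≤ σ i) : ‖bandInv K T σ u v‖ ≤ s⁻¹ := by
  refine l2_norm_rankSum_le hA.left hA.right (inv_nonneg.mpr hs.le) fun i _ => ?_
  split_ifs with hi
  · rw [abs_of_nonneg (inv_nonneg.mpr (hA.nonneg i))]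
    exact inv_anti₀ hs (hT i hi)
  · simpa using hs.le

theorem l2_norm_mul_bandProj_le [DecidableEq n] (hA : IsSVD K A σ u v) {T : Finset ℕ} {t : ℝ}
    (ht : 0 ≤ t) (hT : ∀ i ∈ T, σ i ≤ t) : ‖A * bandProj K T v‖ ≤ t := by
  rw [hA.mul_bandProj]
  refine l2_norm_rankSum_le hA.left hA.right ht fun i _ => ?_
  split_ifs with hi
  · rw [abs_of_nonneg (hA.nonneg i)]
    exact hT i hi
  · simpa using ht

theorem l2_norm_mul_one_sub_bandProj_le [DecidableEq n] (hA : IsSVD K A σ u v) {T : Finset ℕ}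
    {t : ℝ} (ht : 0 ≤ t) (hT : ∀ i, 1 ≤ i → i ∉ T → σ i ≤ t) :
    ‖A * (1 - bandProj K T v)‖ ≤ t := by
  rw [Matrix.mul_sub, Matrix.mul_one, hA.mul_bandProj, hA.eq_rankSum, rankSum_sub]
  refine l2_norm_rankSum_le hA.left hA.right ht fun i hi => ?_
  split_ifs with hiT
  · simpa using ht
  · rw [sub_zero, abs_of_nonneg (hA.nonneg i)]
    exact hT i (Finset.mem_Icc.mp hi).1 hiT

/-- **Weyl's inequality** for singular values. -/
theorem le_add_l2_norm_sub [DecidableEq n] {K' : ℕ} {B : Matrix m n ℝ} {τ : ℕ → ℝ}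
    {x : ℕ → m → ℝ} {y : ℕ → n → ℝ} (hA : IsSVD K A σ u v) (hB : IsSVD K' B τ x y) {j : ℕ}
    (hj : 1 ≤ j) : σ j ≤ τ j + ‖A - B‖ := by
  classical
  rcases (hA.nonneg j).eq_or_lt with h0 | hpos
  · rw [← h0]
    exact add_nonneg (hB.nonneg j) (norm_nonneg _)
  have hjK : j ≤ K := by
    by_contra! h
    exact hpos.ne' (hA.eq_zero j h)
  let f : (Fin j → ℝ) →ₗ[ℝ] (Fin (j - 1) → ℝ) :=
    (Matrix.of fun (i : Fin (j - 1)) (l : Fin j) => y (i + 1) ⬝ᵥ v (l + 1)).mulVecLin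
  have hker : LinearMap.ker f ≠ ⊥ :=
    LinearMap.ker_ne_bot_of_finrank_lt (by simp only [Module.finrank_fin_fun]; omega)
  obtain ⟨c, hc, hc0⟩ := (Submodule.ne_bot_iff _).mp hker
  set z : n → ℝ := ∑ l : Fin j, c l • v (l + 1) with hz
  have hvz : ∀ l : Fin j, v (l + 1) ⬝ᵥ z = c l := by
    intro l
    rw [hz, dotProduct_sum, Finset.sum_eq_single_of_mem l (Finset.mem_univ _)]
    · rw [dotProduct_smul, hA.right _ (Finset.mem_Icc.mpr (by omega)) _
        (Finset.mem_Icc.mpr (by omega))]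
      simp
    · intro i _ hil
      rw [dotProduct_smul, hA.right _ (Finset.mem_Icc.mpr (by omega)) _
        (Finset.mem_Icc.mpr (by omega)), if_neg (by omega)]
      simp
  have hz0 : z ≠ 0 := by
    intro h
    refine hc0 (funext fun l => ?_)
    rw [← hvz l, h]
    simp
  have hyz : ∀ i ∈ Finset.Ico 1 j, y i ⬝ᵥ z = 0 := by
    intro i hi
    rw [Finset.mem_Ico] at hi
    have h := congrFun (LinearMap.mem_ker.mp hc) ⟨i - 1, by omega⟩
    simp only [f, Matrix.mulVecLin_apply, Matrix.mulVec, dotProduct, Matrix.of_apply,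
      Pi.zero_apply, Nat.sub_add_cancel hi.1] at h
    rw [hz, dotProduct_sum, ← h]
    refine Finset.sum_congr rfl fun l _ => ?_
    rw [dotProduct_smul, smul_eq_mul, mul_comm]
    rfl
  have hPz : bandProj K (Finset.Icc 1 j) v *ᵥ z = z := by
    rw [bandProj, rankSum_indicator (Finset.Icc_subset_Icc le_rfl hjK), ← rankSum, rankSum_mulVec]
    simp only [one_mul]
    rw [← Finset.Ico_add_one_right_eq_Icc, Finset.sum_Ico_eq_sum_range, Nat.add_sub_cancel,
      ← Fin.sum_univ_eq_sum_range (fun i => (v (1 + i) ⬝ᵥ z) • v (1 + i))]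
    refine (Finset.sum_congr rfl fun l _ => ?_).trans hz.symm
    rw [add_comm 1, hvz l]
  have hQz : bandProj K' (Finset.Ico 1 j) y *ᵥ z = 0 := by
    rw [bandProj, rankSum_mulVec]
    refine Finset.sum_eq_zero fun i _ => ?_
    split_ifs with hi
    · simp [hyz i hi]
    · simp
  have hle : ∀ i ∈ Finset.Icc 1 j, σ j ≤ σ i := fun i hi =>
    hA.anti i j (Finset.mem_Icc.mp hi).1 (Finset.mem_Icc.mp hi).2
  have hAz : vnorm z ≤ (σ j)⁻¹ * vnorm (A *ᵥ z) := by
    have h1 := vnorm_mulVec_le (bandInv K (Finset.Icc 1 j) σ u v)ᵀ (A *ᵥ z)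
    rw [Matrix.mulVec_mulVec,
      hA.transpose_bandInv_mul fun i hi => (hpos.trans_le (hle i hi)).ne', hPz,
      l2_norm_transpose] at h1
    exact h1.trans (mul_le_mul_of_nonneg_right (hA.l2_norm_bandInv_le hpos hle) (vnorm_nonneg _))
  have hBz : vnorm (B *ᵥ z) ≤ τ j * vnorm z := by
    have h1 := vnorm_mulVec_le (B * (1 - bandProj K' (Finset.Ico 1 j) y)) z
    rw [← Matrix.mulVec_mulVec, Matrix.sub_mulVec, hQz, Matrix.one_mulVec, sub_zero] at h1
    refine h1.trans (mul_le_mul_of_nonneg_right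
      (hB.l2_norm_mul_one_sub_bandProj_le (hB.nonneg j) fun i hi hij => ?_) (vnorm_nonneg _))
    exact hB.anti j i hj (by rw [Finset.mem_Ico] at hij; omega)
  have htri : vnorm (A *ᵥ z) ≤ vnorm (B *ᵥ z) + ‖A - B‖ * vnorm z := by
    have h1 := vnorm_mulVec_le (A - B) z
    have h2 : A *ᵥ z = B *ᵥ z + (A - B) *ᵥ z := by rw [Matrix.sub_mulVec]; abel
    rw [h2]
    refine le_trans ?_ (add_le_add_right h1 _)
    simp only [vnorm_eq_norm_toLp, WithLp.toLp_add]
    exact norm_add_le _ _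
  have hzpos := vnorm_pos hz0
  rw [inv_mul_eq_div, le_div_iff₀ hpos] at hAz
  refine le_of_mul_le_mul_right ?_ hzpos
  linarith

/-- The bound for one side in the coupled pair of estimates behind Wedin's theorem. -/
theorem l2_norm_bandProj_mul_le_add [DecidableEq m] [DecidableEq n] (hA : IsSVD K A σ u v)
    {T : Finset ℕ} {s t : ℝ} (hs : 0 < s) (hT : ∀ i ∈ T, s ≤ σ i) {B : Matrix m n ℝ}
    {P : Matrix n n ℝ} {R : Matrix m m ℝ} (hPn : ‖P‖ ≤ 1) (hBP : R * B = B * P)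
    (hP : P * P = P) (ht : ‖B * P‖ ≤ t) :
    ‖bandProj K T v * P‖ ≤ s⁻¹ * (‖A - B‖ + ‖bandProj K T u * R‖ * t) := by
  have hne : ∀ i ∈ T, σ i ≠ 0 := fun i hi => (hs.trans_le (hT i hi)).ne'
  have hH : ‖(bandInv K T σ u v)ᵀ‖ ≤ s⁻¹ := by
    rw [l2_norm_transpose]
    exact hA.l2_norm_bandInv_le hs hT
  have hHR : (bandInv K T σ u v)ᵀ * bandProj K T u = (bandInv K T σ u v)ᵀ := by
    rw [bandInv_transpose]
    exact hA.transpose.bandInv_mul_bandProj T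
  have hRBP : B * P = R * (B * P) := by
    rw [← Matrix.mul_assoc, hBP, Matrix.mul_assoc, hP]
  have hdecomp : bandProj K T v * P
      = (bandInv K T σ u v)ᵀ * ((A - B) * P + (bandProj K T u * R) * (B * P)) := by
    rw [Matrix.mul_add, Matrix.mul_assoc (bandProj K T u), ← hRBP,
      ← Matrix.mul_assoc _ (bandProj K T u), hHR, ← Matrix.mul_add, ← Matrix.add_mul,
      sub_add_cancel, ← Matrix.mul_assoc, hA.transpose_bandInv_mul hne]
  rw [hdecomp]
  refine l2_norm_mul_le_of_le hH ((norm_add_le _ _).trans (add_le_add ?_ ?_))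
  · simpa using l2_norm_mul_le_of_le (le_refl ‖A - B‖) hPn
  · exact l2_norm_mul_le_of_le le_rfl ht

/-- **Wedin's theorem** for the singular subspaces belonging to separated singular values. -/
theorem l2_norm_bandProj_mul_le [DecidableEq m] [DecidableEq n] (hA : IsSVD K A σ u v)
    {T : Finset ℕ} {s t : ℝ} (ht0 : 0 ≤ t) (hst : t < s) (hT : ∀ i ∈ T, s ≤ σ i)
    {B : Matrix m n ℝ} {P : Matrix n n ℝ} {R : Matrix m m ℝ} (hPn : ‖P‖ ≤ 1) (hRn : ‖R‖ ≤ 1)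
    (hP : P * P = P) (hR : R * R = R) (hPt : Pᵀ = P) (hRt : Rᵀ = R) (hBP : R * B = B * P)
    (ht : ‖B * P‖ ≤ t) :
    ‖bandProj K T v * P‖ ≤ ‖A - B‖ / (s - t) := by
  have hs : 0 < s := ht0.trans_lt hst
  have hBR : P * Bᵀ = Bᵀ * R := by
    have := congrArg Matrix.transpose hBP
    rw [Matrix.transpose_mul, Matrix.transpose_mul, hPt, hRt] at this
    exact this.symm
  have ht' : ‖Bᵀ * R‖ ≤ t := by
    rw [← l2_norm_transpose, Matrix.transpose_mul, Matrix.transpose_transpose, hRt, hBP]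
    exact ht
  have h1 := hA.l2_norm_bandProj_mul_le_add hs hT hPn hBP hP ht
  have h2 := hA.transpose.l2_norm_bandProj_mul_le_add hs hT hRn hBR hR ht'
  rw [← Matrix.transpose_sub, l2_norm_transpose] at h2
  rw [inv_mul_eq_div, le_div_iff₀ hs] at h1 h2
  rw [le_div_iff₀ (sub_pos.mpr hst)]
  set X := ‖bandProj K T v * P‖
  set Y := ‖bandProj K T u * R‖
  rcases le_total X Y with hXY | hXY <;> nlinarith [mul_le_mul_of_nonneg_right hXY ht0]

/-- Two-sided version of Wedin's theorem for the singular values with indices in `[a, b]`. -/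
theorem l2_norm_bandProj_mul_one_sub_le [DecidableEq m] [DecidableEq n] {K' : ℕ}
    {B : Matrix m n ℝ} {τ : ℕ → ℝ} {x : ℕ → m → ℝ} {y : ℕ → n → ℝ} (hA : IsSVD K A σ u v)
    (hB : IsSVD K' B τ x y) {a b : ℕ} (ha : 1 ≤ a) (hab : a ≤ b) {γ : ℝ} (hγ : 0 < γ)
    (hlow : τ (b + 1) + γ ≤ σ b) (hhigh : 1 < a → σ a + γ ≤ τ (a - 1)) :
    ‖bandProj K (Finset.Icc a b) v * (1 - bandProj K' (Finset.Icc a b) y)‖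
      ≤ 2 * ‖A - B‖ / γ := by
  have hsplit : 1 - bandProj K' (Finset.Icc a b) y
      = (1 - bandProj K' (Finset.Icc 1 b) y) + bandProj K' (Finset.Ico 1 a) y := by
    rw [sub_add, sub_right_inj, bandProj, bandProj, bandProj, rankSum_sub]
    refine rankSum_congr (fun i _ => ?_) _ _
    simp only [Finset.mem_Icc, Finset.mem_Ico]
    split_ifs <;> first | omega | simp
  have hmono : ∀ {d : ℝ}, γ ≤ d → ‖A - B‖ / d ≤ ‖A - B‖ / γ := fun hd =>
    div_le_div_of_nonneg_left (norm_nonneg _) hγ hd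
  have h1 : ‖bandProj K (Finset.Icc a b) v * (1 - bandProj K' (Finset.Icc 1 b) y)‖
      ≤ ‖A - B‖ / γ := by
    refine (hA.l2_norm_bandProj_mul_le (s := σ b) (R := 1 - bandProj K' (Finset.Icc 1 b) x)
      (hB.nonneg (b + 1)) (by linarith)
      (fun i hi => hA.anti i b (by rw [Finset.mem_Icc] at hi; omega) (Finset.mem_Icc.mp hi).2)
      (hB.right.l2_norm_one_sub_bandProj_le _) (hB.left.l2_norm_one_sub_bandProj_le _)
      ?_ ?_ ?_ ?_ ?_ ?_).trans (hmono (by linarith))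
    · simp [mul_sub, sub_mul, hB.right.bandProj_mul_self]
    · simp [mul_sub, sub_mul, hB.left.bandProj_mul_self]
    · simp [bandProj_transpose]
    · simp [bandProj_transpose]
    · rw [Matrix.mul_sub, Matrix.sub_mul, hB.bandProj_mul, Matrix.one_mul, Matrix.mul_one]
    · refine hB.l2_norm_mul_one_sub_bandProj_le (hB.nonneg _) fun i hi hib => ?_
      exact hB.anti (b + 1) i (by omega) (by rw [Finset.mem_Icc] at hib; omega)
  have h2 : ‖bandProj K (Finset.Icc a b) v * bandProj K' (Finset.Ico 1 a) y‖
      ≤ ‖A - B‖ / γ := by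
    rcases ha.eq_or_lt with rfl | ha1
    · have : bandProj K' (Finset.Ico 1 1) y = 0 := by simp [bandProj, rankSum]
      rw [this, mul_zero, norm_zero]
      positivity
    rw [← l2_norm_transpose, Matrix.transpose_mul, bandProj_transpose, bandProj_transpose,
      norm_sub_rev A B]
    have hgap := hhigh ha1
    refine (hB.l2_norm_bandProj_mul_le (s := τ (a - 1)) (R := bandProj K (Finset.Icc a b) u)
      (hA.nonneg a) (by linarith)
      (fun i hi => hB.anti i (a - 1) (Finset.mem_Ico.mp hi).1
        (by rw [Finset.mem_Ico] at hi; omega))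
      (hA.right.l2_norm_bandProj_le _) (hA.left.l2_norm_bandProj_le _)
      (hA.right.bandProj_mul_self _) (hA.left.bandProj_mul_self _) (bandProj_transpose _ _ _)
      (bandProj_transpose _ _ _) (hA.bandProj_mul _) (hA.l2_norm_mul_bandProj_le (hA.nonneg a)
        fun i hi => hA.anti a i ha (Finset.mem_Icc.mp hi).1)).trans ?_
    rw [norm_sub_rev B A]
    exact hmono (by linarith)
  rw [hsplit, Matrix.mul_add, two_mul, add_div]
  exact (norm_add_le _ _).trans (add_le_add h1 h2)

/-- Lipschitz continuity of the pseudoinverse of a band of separated singular values. -/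
theorem l2_norm_bandInv_sub_le [DecidableEq m] [DecidableEq n] {K' : ℕ}
    {B : Matrix m n ℝ} {τ : ℕ → ℝ} {x : ℕ → m → ℝ} {y : ℕ → n → ℝ} (hA : IsSVD K A σ u v)
    (hB : IsSVD K' B τ x y) {a b : ℕ} (ha : 1 ≤ a) (hab : a ≤ b) {γ : ℝ} (hγ : 0 < γ)
    (hlow : τ (b + 1) + γ ≤ σ b) (hhigh : 1 < a → σ a + γ ≤ τ (a - 1))
    (hlow' : σ (b + 1) + γ ≤ τ b) (hhigh' : 1 < a → τ a + γ ≤ σ (a - 1)) :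
    ‖bandInv K (Finset.Icc a b) σ u v - bandInv K' (Finset.Icc a b) τ x y‖
      ≤ 5 * ‖A - B‖ / γ ^ 2 := by
  have hσ : ∀ i ∈ Finset.Icc a b, γ ≤ σ i := fun i hi => by
    rw [Finset.mem_Icc] at hi
    linarith [hA.anti i b (by omega) hi.2, hB.nonneg (b + 1)]
  have hτ : ∀ i ∈ Finset.Icc a b, γ ≤ τ i := fun i hi => by
    rw [Finset.mem_Icc] at hi
    linarith [hB.anti i b (by omega) hi.2, hA.nonneg (b + 1)]
  have hHA := hA.l2_norm_bandInv_le hγ hσ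
  have hHB := hB.l2_norm_bandInv_le hγ hτ
  have hP := hA.l2_norm_bandProj_mul_one_sub_le hB ha hab hγ hlow hhigh
  have hR := hB.transpose.l2_norm_bandProj_mul_one_sub_le hA.transpose ha hab hγ hlow' hhigh'
  rw [← Matrix.transpose_sub, l2_norm_transpose, norm_sub_rev, ← l2_norm_transpose,
    Matrix.transpose_mul, Matrix.transpose_sub, Matrix.transpose_one, bandProj_transpose,
    bandProj_transpose] at hR
  have hHAP := hA.bandInv_mul_bandProj (Finset.Icc a b)
  have hHBR : bandProj K' (Finset.Icc a b) x * bandInv K' (Finset.Icc a b) τ x y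
      = bandInv K' (Finset.Icc a b) τ x y := by
    have h := congrArg Matrix.transpose (hB.transpose.bandInv_mul_bandProj (Finset.Icc a b))
    rwa [Matrix.transpose_mul, bandProj_transpose, bandInv_transpose] at h
  have hPB := hB.transpose_mul_bandInv (T := Finset.Icc a b) fun i hi => (hγ.trans_le (hτ i hi)).ne'
  have hRA : bandInv K (Finset.Icc a b) σ u v * Aᵀ = bandProj K (Finset.Icc a b) u := by
    have h := hA.transpose.transpose_bandInv_mul (T := Finset.Icc a b)
      fun i hi => (hγ.trans_le (hσ i hi)).ne'
    rwa [bandInv_transpose] at h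
  set HA := bandInv K (Finset.Icc a b) σ u v
  set HB := bandInv K' (Finset.Icc a b) τ x y
  set PA := bandProj K (Finset.Icc a b) v
  set PB := bandProj K' (Finset.Icc a b) y
  set RA := bandProj K (Finset.Icc a b) u
  set RB := bandProj K' (Finset.Icc a b) x
  have hdecomp : HA - HB
      = HA * (PA * (1 - PB)) - HA * (A - B)ᵀ * HB - (1 - RA) * RB * HB := by
    rw [← Matrix.mul_assoc, hHAP, Matrix.transpose_sub, Matrix.mul_sub HA Aᵀ, hRA, Matrix.sub_mul,
      Matrix.mul_assoc HA, hPB, Matrix.mul_assoc (1 - RA), hHBR, Matrix.sub_mul, Matrix.mul_sub,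
      Matrix.one_mul, Matrix.mul_one]
    abel
  have e1 := l2_norm_mul_le_of_le hHA hP
  have e2 := l2_norm_mul_le_of_le
    (l2_norm_mul_le_of_le hHA (l2_norm_transpose (A - B)).le) hHB
  have e3 := l2_norm_mul_le_of_le hR hHB
  rw [hdecomp]
  refine (norm_sub_le _ _).trans ((add_le_add ((norm_sub_le _ _).trans (add_le_add e1 e2)) e3).trans
    (le_of_eq ?_))
  field_simp
  ring

theorem l2_norm_bandInv_sub_le_of_near [DecidableEq m] [DecidableEq n] {K₁ K₂ : ℕ}
    {A₁ A₂ : Matrix m n ℝ} {τ₁ τ₂ : ℕ → ℝ} {x₁ x₂ : ℕ → m → ℝ} {y₁ y₂ : ℕ → n → ℝ}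
    (hA : IsSVD K A σ u v) (h₁ : IsSVD K₁ A₁ τ₁ x₁ y₁) (h₂ : IsSVD K₂ A₂ τ₂ x₂ y₂)
    {a b : ℕ} (ha : 1 ≤ a) (hab : a ≤ b) {g : ℝ} (hg : 0 < g) (hlow : σ (b + 1) + g ≤ σ b)
    (hhigh : 1 < a → σ a + g ≤ σ (a - 1)) (hA₁ : ‖A₁ - A‖ ≤ g / 4) (hA₂ : ‖A₂ - A‖ ≤ g / 4) :
    ‖bandInv K₁ (Finset.Icc a b) τ₁ x₁ y₁ - bandInv K₂ (Finset.Icc a b) τ₂ x₂ y₂‖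
      ≤ 20 * ‖A₁ - A₂‖ / g ^ 2 := by
  have hup₁ : ∀ j, 1 ≤ j → τ₁ j ≤ σ j + g / 4 := fun j hj => by
    linarith [h₁.le_add_l2_norm_sub hA hj]
  have hup₂ : ∀ j, 1 ≤ j → τ₂ j ≤ σ j + g / 4 := fun j hj => by
    linarith [h₂.le_add_l2_norm_sub hA hj]
  rw [norm_sub_rev] at hA₁ hA₂
  have hdown₁ : ∀ j, 1 ≤ j → σ j ≤ τ₁ j + g / 4 := fun j hj => by
    linarith [hA.le_add_l2_norm_sub h₁ hj]
  have hdown₂ : ∀ j, 1 ≤ j → σ j ≤ τ₂ j + g / 4 := fun j hj => by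
    linarith [hA.le_add_l2_norm_sub h₂ hj]
  have hb : 1 ≤ b := ha.trans hab
  refine (h₁.l2_norm_bandInv_sub_le h₂ ha hab (half_pos hg) ?_ ?_ ?_ ?_).trans (le_of_eq ?_)
  · linarith [hup₂ (b + 1) (by omega), hdown₁ b hb]
  · intro ha1
    linarith [hup₁ a ha, hdown₂ (a - 1) (by omega), hhigh ha1]
  · linarith [hup₁ (b + 1) (by omega), hdown₂ b hb]
  · intro ha1
    linarith [hup₂ a ha, hdown₁ (a - 1) (by omega), hhigh ha1]
  · field_simp
    ring

theorem one_sub_bandProj_mul_transpose [DecidableEq n] (hA : IsSVD K A σ u v) :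
    (1 - bandProj K (Finset.Icc 1 K) v) * Aᵀ = 0 := by
  rw [Matrix.sub_mul, Matrix.one_mul, hA.transpose.bandProj_mul, hA.transpose.mul_bandProj,
    hA.transpose.eq_rankSum, rankSum_sub]
  exact Finset.sum_eq_zero fun i hi => by simp only [if_pos hi, sub_self, zero_smul]

theorem one_sub_bandProj_mul_bandProj [DecidableEq n] (hA : IsSVD K A σ u v) (T : Finset ℕ) :
    (1 - bandProj K (Finset.Icc 1 K) v) * bandProj K T v = 0 := by
  rw [Matrix.sub_mul, Matrix.one_mul, bandProj, bandProj, rankSum_mul hA.right, rankSum_sub]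
  exact Finset.sum_eq_zero fun i hi => by simp only [if_pos hi, one_mul, sub_self, zero_smul]

/-- Exact form of the remainder in the first-order expansion of a singular projection, compressed
to the kernel of the unperturbed matrix. -/
theorem projection_remainder_eq [DecidableEq n] {l : Type*} {K' : ℕ} {E : Matrix m n ℝ}
    {τ : ℕ → ℝ} {x : ℕ → m → ℝ} {y : ℕ → n → ℝ} (hA : IsSVD K A σ u v)
    (hB : IsSVD K' (A + E) τ x y) {T : Finset ℕ} (hT : ∀ i ∈ T, τ i ≠ 0) (W : Matrix n l ℝ) :
    (1 - bandProj K (Finset.Icc 1 K) v) * (bandProj K' T y - bandProj K T v) * W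
        - (1 - bandProj K (Finset.Icc 1 K) v) * Eᵀ * bandInv K T σ u v * W
      = (1 - bandProj K (Finset.Icc 1 K) v)
        * (Eᵀ * (bandInv K' T τ x y - bandInv K T σ u v)) * W := by
  have h0 : (1 - bandProj K (Finset.Icc 1 K) v) * bandProj K' T y
      = (1 - bandProj K (Finset.Icc 1 K) v) * Eᵀ * bandInv K' T τ x y := by
    rw [← hB.transpose_mul_bandInv hT, ← Matrix.mul_assoc, Matrix.transpose_add, Matrix.mul_add,
      hA.one_sub_bandProj_mul_transpose, zero_add]
  rw [Matrix.mul_sub _ (bandProj K' T y), hA.one_sub_bandProj_mul_bandProj, sub_zero, h0,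
    ← Matrix.sub_mul, ← Matrix.mul_sub, Matrix.mul_assoc _ Eᵀ]

/-- Lipschitz bound, in the perturbation, for the compressed remainder of a singular projection. -/
theorem l2_norm_projection_remainder_sub_le [DecidableEq m] [DecidableEq n] {l : Type*} [Fintype l]
    [DecidableEq l] {K₁ K₂ : ℕ} {E₁ E₂ : Matrix m n ℝ} {τ₁ τ₂ : ℕ → ℝ} {x₁ x₂ : ℕ → m → ℝ}
    {y₁ y₂ : ℕ → n → ℝ} (hA : IsSVD K A σ u v) (h₁ : IsSVD K₁ (A + E₁) τ₁ x₁ y₁)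
    (h₂ : IsSVD K₂ (A + E₂) τ₂ x₂ y₂) {a b : ℕ} (ha : 1 ≤ a) (hab : a ≤ b) {g : ℝ} (hg : 0 < g)
    (hlow : σ (b + 1) + g ≤ σ b) (hhigh : 1 < a → σ a + g ≤ σ (a - 1))
    (hE : max ‖E₁‖ ‖E₂‖ ≤ g / 4) {W : Matrix n l ℝ} (hW : ‖W‖ ≤ 1) :
    ‖((1 - bandProj K (Finset.Icc 1 K) v)
          * (bandProj K₁ (Finset.Icc a b) y₁ - bandProj K (Finset.Icc a b) v) * W
        - (1 - bandProj K (Finset.Icc 1 K) v) * E₁ᵀ * bandInv K (Finset.Icc a b) σ u v * W)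
      - ((1 - bandProj K (Finset.Icc 1 K) v)
          * (bandProj K₂ (Finset.Icc a b) y₂ - bandProj K (Finset.Icc a b) v) * W
        - (1 - bandProj K (Finset.Icc 1 K) v) * E₂ᵀ * bandInv K (Finset.Icc a b) σ u v * W)‖
      ≤ 40 * (max ‖E₁‖ ‖E₂‖ / g ^ 2) * ‖E₁ - E₂‖ := by
  have hb : 1 ≤ b := ha.trans hab
  have hE₁ : ‖A + E₁ - A‖ ≤ g / 4 := by
    rw [add_sub_cancel_left]
    exact (le_max_left _ _).trans hE
  have hE₂ : ‖A + E₂ - A‖ ≤ g / 4 := by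
    rw [add_sub_cancel_left]
    exact (le_max_right _ _).trans hE
  have hAA : ‖A - A‖ ≤ g / 4 := by
    rw [sub_self, norm_zero]
    positivity
  have hH := hA.l2_norm_bandInv_sub_le_of_near h₁ hA ha hab hg hlow hhigh hE₁ hAA
  have hH' := hA.l2_norm_bandInv_sub_le_of_near h₁ h₂ ha hab hg hlow hhigh hE₁ hE₂
  rw [add_sub_cancel_left] at hH
  rw [add_sub_add_left_eq_sub] at hH'
  have hσb : g ≤ σ b := by linarith [hA.nonneg (b + 1)]
  rw [norm_sub_rev] at hE₁ hE₂
  have hne₁ : ∀ i ∈ Finset.Icc a b, τ₁ i ≠ 0 := fun i hi => by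
    rw [Finset.mem_Icc] at hi
    have h := h₁.anti i b (by omega) hi.2
    exact ne_of_gt (by linarith [hA.le_add_l2_norm_sub h₁ hb])
  have hne₂ : ∀ i ∈ Finset.Icc a b, τ₂ i ≠ 0 := fun i hi => by
    rw [Finset.mem_Icc] at hi
    have h := h₂.anti i b (by omega) hi.2
    exact ne_of_gt (by linarith [hA.le_add_l2_norm_sub h₂ hb])
  rw [hA.projection_remainder_eq h₁ hne₁, hA.projection_remainder_eq h₂ hne₂]
  have hQ := hA.right.l2_norm_one_sub_bandProj_le (Finset.Icc 1 K)
  set H := bandInv K (Finset.Icc a b) σ u v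
  set H₁ := bandInv K₁ (Finset.Icc a b) τ₁ x₁ y₁
  set H₂ := bandInv K₂ (Finset.Icc a b) τ₂ x₂ y₂
  set Q := 1 - bandProj K (Finset.Icc 1 K) v
  have hdiff : Q * (E₁ᵀ * (H₁ - H)) * W - Q * (E₂ᵀ * (H₂ - H)) * W
      = Q * ((E₁ - E₂)ᵀ * (H₁ - H) + E₂ᵀ * (H₁ - H₂)) * W := by
    rw [← Matrix.sub_mul, ← Matrix.mul_sub]
    congr 2
    simp only [Matrix.transpose_sub, Matrix.mul_sub, Matrix.sub_mul]
    abel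
  have hμ : ‖E₁‖ ≤ max ‖E₁‖ ‖E₂‖ := le_max_left _ _
  have hμ' : ‖E₂‖ ≤ max ‖E₁‖ ‖E₂‖ := le_max_right _ _
  set μ := max ‖E₁‖ ‖E₂‖
  have e1 := l2_norm_mul_le_of_le (l2_norm_transpose (E₁ - E₂)).le hH
  have e2 := l2_norm_mul_le_of_le (l2_norm_transpose E₂).le hH'
  rw [hdiff]
  refine (l2_norm_mul_le_of_le (l2_norm_mul_le_of_le hQ
    ((norm_add_le _ _).trans (add_le_add e1 e2))) hW).trans ?_
  calc 1 * (‖E₁ - E₂‖ * (20 * ‖E₁‖ / g ^ 2) + ‖E₂‖ * (20 * ‖E₁ - E₂‖ / g ^ 2)) * 1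
      = 20 * ((‖E₁‖ + ‖E₂‖) / g ^ 2) * ‖E₁ - E₂‖ := by ring
    _ ≤ 20 * ((μ + μ) / g ^ 2) * ‖E₁ - E₂‖ := by gcongr
    _ = 40 * (μ / g ^ 2) * ‖E₁ - E₂‖ := by ring

end IsSVD

end IsSVD

theorem spectral_projector_remainder_lipschitz (hk : k ≤ min p n)
    (hσpos : ∀ i ∈ Finset.Icc 1 k, 0 < σ i)
    (hσmono : ∀ i ∈ Finset.Icc 1 k, ∀ i' ∈ Finset.Icc 1 k, i ≤ i' → σ i' ≤ σ i)
    (hσtop : σ (k + 1) = 0)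
    (hu : ∀ i ∈ Finset.Icc 1 k, ∀ i' ∈ Finset.Icc 1 k,
      ∑ x, u i x * u i' x = if i = i' then (1 : ℝ) else 0)
    (hv : ∀ i ∈ Finset.Icc 1 k, ∀ i' ∈ Finset.Icc 1 k,
      ∑ y, v i y * v i' y = if i = i' then (1 : ℝ) else 0)
    (hM : M = ∑ i ∈ Finset.Icc 1 k, σ i • Matrix.vecMulVec (u i) (v i))
    -- an SVD of the perturbed matrix M + E
    (σhat : ℕ → ℝ) (uhat : ℕ → Fin p → ℝ) (vhat : ℕ → Fin n → ℝ)
    (hσhatnn : ∀ i ∈ Finset.Icc 1 (min p n), 0 ≤ σhat i)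
    (hσhatmono : ∀ i ∈ Finset.Icc 1 (min p n), ∀ i' ∈ Finset.Icc 1 (min p n),
      i ≤ i' → σhat i' ≤ σhat i)
    (huhat : ∀ i ∈ Finset.Icc 1 (min p n), ∀ i' ∈ Finset.Icc 1 (min p n),
      ∑ x, uhat i x * uhat i' x = if i = i' then (1 : ℝ) else 0)
    (hvhat : ∀ i ∈ Finset.Icc 1 (min p n), ∀ i' ∈ Finset.Icc 1 (min p n),
      ∑ y, vhat i y * vhat i' y = if i = i' then (1 : ℝ) else 0)
    (hMhat : M + E = ∑ i ∈ Finset.Icc 1 (min p n),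
      σhat i • Matrix.vecMulVec (uhat i) (vhat i))
    -- an SVD of the perturbed matrix M + E'
    (σhat' : ℕ → ℝ) (uhat' : ℕ → Fin p → ℝ) (vhat' : ℕ → Fin n → ℝ)
    (hσhatnn' : ∀ i ∈ Finset.Icc 1 (min p n), 0 ≤ σhat' i)
    (hσhatmono' : ∀ i ∈ Finset.Icc 1 (min p n), ∀ i' ∈ Finset.Icc 1 (min p n),
      i ≤ i' → σhat' i' ≤ σhat' i)
    (huhat' : ∀ i ∈ Finset.Icc 1 (min p n), ∀ i' ∈ Finset.Icc 1 (min p n),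
      ∑ x, uhat' i x * uhat' i' x = if i = i' then (1 : ℝ) else 0)
    (hvhat' : ∀ i ∈ Finset.Icc 1 (min p n), ∀ i' ∈ Finset.Icc 1 (min p n),
      ∑ y, vhat' i y * vhat' i' y = if i = i' then (1 : ℝ) else 0)
    (hMhat' : M + E' = ∑ i ∈ Finset.Icc 1 (min p n),
      σhat' i • Matrix.vecMulVec (uhat' i) (vhat' i))
    (ha : 1 ≤ a) (hab : a ≤ b) (hbk : b ≤ k)
    -- the singular value gap, with the convention σ₀ = +∞
    (g : ℝ) (hgpos : 0 < g)
    (hg : g = if a = 1 then σ b - σ (b + 1)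
              else min (σ (a - 1) - σ a) (σ b - σ (b + 1)))
    (hV : ∀ x i, V x i = v i.1 x)
    (hVab : ∀ x i, Vab x i = v i.1 x)
    (hVhatab : ∀ x i, Vhatab x i = vhat i.1 x)
    (hVhatab' : ∀ x i, Vhatab' x i = vhat' i.1 x)
    (hS : S = (1 - V * Vᵀ) * (Vhatab * Vhatabᵀ - Vab * Vabᵀ) * Vab
        - ∑ j ∈ Finset.Icc a b,
            (σ j)⁻¹ • ((1 - V * Vᵀ) * Eᵀ * Matrix.vecMulVec (u j) (v j) * Vab))
    (hS' : S' = (1 - V * Vᵀ) * (Vhatab' * Vhatab'ᵀ - Vab * Vabᵀ) * Vab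
        - ∑ j ∈ Finset.Icc a b,
            (σ j)⁻¹ • ((1 - V * Vᵀ) * E'ᵀ * Matrix.vecMulVec (u j) (v j) * Vab))
    (hsmall : max (opNorm E) (opNorm E') ≤ g / 4) :
    opNorm (S - S') ≤ 1024 * (1 + (σ a - σ b) / g)
        * (max (opNorm E) (opNorm E') / g ^ 2) * opNorm (E - E') := by
  have hKb : b ≤ min p n := hbk.trans hk
  have hTk : Finset.Icc a b ⊆ Finset.Icc 1 k := Finset.Icc_subset_Icc ha hbk
  have hTK : Finset.Icc a b ⊆ Finset.Icc 1 (min p n) := Finset.Icc_subset_Icc ha hKb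
  have hA := IsSVD.of_le (fun i hi => (hσpos i hi).le) hσmono hu hv hM
  have hB := IsSVD.of_le hσhatnn hσhatmono huhat hvhat hMhat
  have hB' := IsSVD.of_le hσhatnn' hσhatmono' huhat' hvhat' hMhat'
  have hσ : ∀ i, 1 ≤ i → i ≤ k + 1 → (if i ∈ Finset.Icc 1 k then σ i else 0) = σ i := by
    intro i hi hik
    rcases hik.eq_or_lt with rfl | hik
    · rw [hσtop, ite_self]
    · exact if_pos (Finset.mem_Icc.mpr ⟨hi, by omega⟩)
  set τ : ℕ → ℝ := fun i => if i ∈ Finset.Icc 1 k then σ i else 0 with hτ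
  have hlow : τ (b + 1) + g ≤ τ b := by
    simp only [hτ]
    rw [hσ _ (by omega) (by omega), hσ _ (by omega) (by omega), hg]
    split_ifs
    · linarith
    · linarith [min_le_right (σ (a - 1) - σ a) (σ b - σ (b + 1))]
  have hhigh : 1 < a → τ a + g ≤ τ (a - 1) := by
    intro ha1
    simp only [hτ]
    rw [hσ _ (by omega) (by omega), hσ _ (by omega) (by omega), hg, if_neg ha1.ne']
    linarith [min_le_left (σ (a - 1) - σ a) (σ b - σ (b + 1))]
  simp only [opNorm_eq_l2_norm] at hsmall ⊢
  have hVV : V * Vᵀ = bandProj k (Finset.Icc 1 k) v := mul_transpose_eq_bandProj subset_rfl hV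
  have hWW : Vab * Vabᵀ = bandProj k (Finset.Icc a b) v := mul_transpose_eq_bandProj hTk hVab
  have hlin : ∀ F : Matrix (Fin p) (Fin n) ℝ, ∑ j ∈ Finset.Icc a b,
      (σ j)⁻¹ • ((1 - V * Vᵀ) * Fᵀ * Matrix.vecMulVec (u j) (v j) * Vab)
      = (1 - V * Vᵀ) * Fᵀ * bandInv k (Finset.Icc a b) τ u v * Vab := by
    intro F
    rw [bandInv, rankSum_indicator hTk, Matrix.mul_sum, Matrix.sum_mul]
    refine Finset.sum_congr rfl fun j hj => ?_
    simp only [hτ, if_pos (hTk hj), Matrix.mul_smul, Matrix.smul_mul]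
  have hW : ‖Vab‖ ≤ 1 := l2_norm_le_one_of_mul_transpose_self (by
    rw [hWW]
    exact hA.right.l2_norm_bandProj_le _)
  have hmain := hA.l2_norm_projection_remainder_sub_le hB hB' ha hab hgpos hlow hhigh hsmall hW
  rw [← hVV, ← hWW, ← mul_transpose_eq_bandProj hTK hVhatab,
    ← mul_transpose_eq_bandProj hTK hVhatab', ← hlin, ← hlin, ← hS, ← hS'] at hmain
  refine hmain.trans ?_
  have hspread : 0 ≤ (σ a - σ b) / g := div_nonneg (sub_nonneg.mpr (hσmono a
    (Finset.mem_Icc.mpr ⟨ha, hab.trans hbk⟩) b (Finset.mem_Icc.mpr ⟨ha.trans hab, hbk⟩) hab))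
    hgpos.le
  have hfactor : (40 : ℝ) ≤ 1024 * (1 + (σ a - σ b) / g) := by linarith
  gcongr

end SingularValuePerturbation
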